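/- There exists N : ℕ such that for all n ≥ N the following holds. Let G be a simple graph on Fin n that is not 3-colorable (¬ G.Colorable 3). Let α, α' : Fin n → ℂ and β, β' : Fin n → Fin 3 → ℂ satisfy ∑ i, ‖α i‖² = 1, ∑ i, ‖α' i‖² = 1, and for every i, ∑ j, ‖β i j‖² = 1 and ∑ j, ‖β' i j‖² = 1; define ψ (i,j) = α i * β i j and φ (i,j) = α' i * β' i j. Define F₁ = (1 − ‖∑ p, conj (ψ p) * φ p‖²)/2; F₂ = (∑ i, ∑ over pairs j ≠ j', ‖ψ (i,j)‖² * ‖φ (i,j')‖²) + (∑ over ordered pairs (i,i') with G.Adj i i', ∑ j, ‖ψ (i,j)‖² * ‖φ (i',j)‖²); and F₃ = ((∑ j, ‖v j‖²) − ‖∑ j, conj (u j) * v j‖²) + ((∑ j, ‖v' j‖²) − ‖∑ j, conj (u j) * v' j‖²), where v j = (1/Real.sqrt 3) * (ψ (j,0) + ψ (j,1) + ψ (j,2)), v' j = (1/Real.sqrt 3) * (φ (j,0) + φ (j,1) + φ (j,2)), and u j = 1/Real.sqrt n. Then (F₁ + F₂ + F₃)/3 ≥ 1/(24*n⁶). 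-/

import Mathlib

open scoped ComplexConjugate

/-- Pythagoras for the projection of `v` onto a unit vector `u`. -/
lemma sum_norm_sq_sub_proj {ι : Type*} [Fintype ι] (u v : ι → ℂ) (hu : ∑ i, ‖u i‖ ^ 2 = 1) :
    ∑ i, ‖v i - (∑ j, conj (u j) * v j) * u i‖ ^ 2
      = ∑ i, ‖v i‖ ^ 2 - ‖∑ j, conj (u j) * v j‖ ^ 2 := by
  set w := ∑ j, conj (u j) * v j with hw
  have expand : ∀ i, ‖v i - w * u i‖ ^ 2
      = ‖v i‖ ^ 2 - 2 * (conj w * (conj (u i) * v i)).re + ‖w‖ ^ 2 * ‖u i‖ ^ 2 := by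
    intro i
    simp only [Complex.sq_norm, Complex.normSq_apply, Complex.sub_re, Complex.sub_im,
      Complex.mul_re, Complex.mul_im, Complex.conj_re, Complex.conj_im]
    ring
  have hre : ∑ i, (conj w * (conj (u i) * v i)).re = ‖w‖ ^ 2 := by
    rw [← Complex.re_sum, ← Finset.mul_sum, ← hw, Complex.sq_norm, Complex.normSq_apply]
    simp
  simp only [expand, Finset.sum_add_distrib, Finset.sum_sub_distrib, ← Finset.mul_sum, hre, hu]
  ring

/-- The moduli of unit vectors are at distance controlled by the swap test. -/
lemma sum_sq_norm_sub_norm_le {ι : Type*} [Fintype ι] (ψ φ : ι → ℂ)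
    (hψ : ∑ p, ‖ψ p‖ ^ 2 = 1) (hφ : ∑ p, ‖φ p‖ ^ 2 = 1) :
    ∑ p, (‖ψ p‖ - ‖φ p‖) ^ 2 ≤ 2 * (1 - ‖∑ p, conj (ψ p) * φ p‖ ^ 2) := by
  have expand : ∑ p, (‖ψ p‖ - ‖φ p‖) ^ 2 = 2 - 2 * ∑ p, ‖ψ p‖ * ‖φ p‖ := by
    have : ∀ p, (‖ψ p‖ - ‖φ p‖) ^ 2 = ‖ψ p‖ ^ 2 + ‖φ p‖ ^ 2 - 2 * (‖ψ p‖ * ‖φ p‖) := by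
      intro p; ring
    simp only [this, Finset.sum_add_distrib, Finset.sum_sub_distrib, ← Finset.mul_sum, hψ, hφ]
    ring
  have hle : ‖∑ p, conj (ψ p) * φ p‖ ≤ ∑ p, ‖ψ p‖ * ‖φ p‖ :=
    (norm_sum_le _ _).trans_eq (by simp)
  have hone : ∑ p, ‖ψ p‖ * ‖φ p‖ ≤ 1 := by
    have := Finset.sum_nonneg fun p (_ : p ∈ Finset.univ) => sq_nonneg (‖ψ p‖ - ‖φ p‖)
    linarith
  nlinarith [norm_nonneg (∑ p, conj (ψ p) * φ p)]

lemma abs_sq_sub_sq_le_of_sq_sub_le {a b r : ℝ} (ha : 0 ≤ a) (hb : 0 ≤ b) (ha1 : a ≤ 1)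
    (hb1 : b ≤ 1) (hr : 0 ≤ r) (h : (a - b) ^ 2 ≤ r ^ 2) : |a ^ 2 - b ^ 2| ≤ 2 * r := by
  have hab := abs_le_of_sq_le_sq h hr
  have : a ^ 2 - b ^ 2 = (a + b) * (a - b) := by ring
  rw [this, abs_mul, abs_of_nonneg (by positivity)]
  exact mul_le_mul (by linarith) hab (abs_nonneg _) (by norm_num)

lemma norm_le_one_of_sum_sq_eq_one {ι : Type*} [Fintype ι] {ψ : ι → ℂ}
    (hψ : ∑ p, ‖ψ p‖ ^ 2 = 1) (p : ι) : ‖ψ p‖ ≤ 1 := by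
  have h := Finset.single_le_sum (f := fun p => ‖ψ p‖ ^ 2) (fun _ _ => sq_nonneg _)
    (Finset.mem_univ p)
  exact (sq_le_one_iff₀ (norm_nonneg _)).1 (h.trans_eq hψ)

/-- Lower bound for `‖x + y + z‖ ^ 2`, estimating each cross term by the product of the moduli. -/
lemma norm_add_add_sq_ge (x y z : ℂ) :
    ‖x‖ ^ 2 + ‖y‖ ^ 2 + ‖z‖ ^ 2 - 2 * (‖x‖ * ‖y‖ + ‖x‖ * ‖z‖ + ‖y‖ * ‖z‖) ≤ ‖x + y + z‖ ^ 2 := by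
  have expand : ‖x + y + z‖ ^ 2 = ‖x‖ ^ 2 + ‖y‖ ^ 2 + ‖z‖ ^ 2
      + 2 * ((conj x * y).re + (conj x * z).re + (conj y * z).re) := by
    simp only [Complex.sq_norm, Complex.normSq_apply, Complex.add_re, Complex.add_im,
      Complex.mul_re, Complex.conj_re, Complex.conj_im]
    ring
  have key : ∀ a b : ℂ, -(‖a‖ * ‖b‖) ≤ (conj a * b).re := by
    intro a b
    have h := (abs_le.1 (Complex.abs_re_le_norm (conj a * b))).1
    rwa [norm_mul, Complex.norm_conj] at h
  linarith [key x y, key x z, key y z]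

/-- Squared norm of the amplitude of the uniform colour superposition. -/
lemma norm_uniform_color_sq (x y z : ℂ) :
    ‖(1 / (Real.sqrt 3 : ℂ)) * (x + y + z)‖ ^ 2 = ‖x + y + z‖ ^ 2 / 3 := by
  rw [norm_mul, mul_pow, norm_div, norm_one, Complex.norm_real, Real.norm_eq_abs, div_pow, sq_abs,
    Real.sq_sqrt (by norm_num)]
  ring

lemma norm_uniform_color_sq_le (x y z : ℂ) :
    ‖(1 / (Real.sqrt 3 : ℂ)) * (x + y + z)‖ ^ 2 ≤ ‖x‖ ^ 2 + ‖y‖ ^ 2 + ‖z‖ ^ 2 := by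
  rw [norm_uniform_color_sq]
  have h := norm_add₃_le (a := x) (b := y) (c := z)
  nlinarith [norm_nonneg (x + y + z), sq_nonneg (‖x‖ - ‖y‖), sq_nonneg (‖x‖ - ‖z‖),
    sq_nonneg (‖y‖ - ‖z‖)]

lemma sum_norm_sq_product {ι κ : Type*} [Fintype ι] [Fintype κ] {α : ι → ℂ} {β : ι → κ → ℂ}
    {ψ : ι × κ → ℂ} (hα : ∑ i, ‖α i‖ ^ 2 = 1) (hβ : ∀ i, ∑ j, ‖β i j‖ ^ 2 = 1)
    (hψ : ∀ i j, ψ (i, j) = α i * β i j) : ∑ p, ‖ψ p‖ ^ 2 = 1 := by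
  simp only [Fintype.sum_prod_type, hψ, norm_mul, mul_pow, ← Finset.mul_sum, hβ, mul_one, hα]

/-- If each node has nearly one colour, the uniform colour outcome has probability near `1/3`. -/
lemma uniform_color_prob_ge {ι : Type*} [Fintype ι] (ψ : ι × Fin 3 → ℂ)
    (hψ : ∑ p, ‖ψ p‖ ^ 2 = 1) {S t : ℝ} (ht : 0 < t)
    (hS : ∑ i, (‖ψ (i, 0)‖ ^ 2 * ‖ψ (i, 1)‖ ^ 2 + ‖ψ (i, 0)‖ ^ 2 * ‖ψ (i, 2)‖ ^ 2
      + ‖ψ (i, 1)‖ ^ 2 * ‖ψ (i, 2)‖ ^ 2) ≤ S) :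
    (1 - (3 * Fintype.card ι * t + S / t)) / 3
      ≤ ∑ i, ‖(1 / (Real.sqrt 3 : ℂ)) * (ψ (i, 0) + ψ (i, 1) + ψ (i, 2))‖ ^ 2 := by
  have amgm : ∀ x y : ℝ, 2 * (x * y) ≤ t + x ^ 2 * y ^ 2 / t := by
    intro x y
    have : t + x ^ 2 * y ^ 2 / t - 2 * (x * y) = (t - x * y) ^ 2 / t := by field_simp; ring
    have : 0 ≤ (t - x * y) ^ 2 / t := by positivity
    linarith
  have hpt : ∀ i, (‖ψ (i, 0)‖ ^ 2 + ‖ψ (i, 1)‖ ^ 2 + ‖ψ (i, 2)‖ ^ 2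
      - (3 * t + (‖ψ (i, 0)‖ ^ 2 * ‖ψ (i, 1)‖ ^ 2 + ‖ψ (i, 0)‖ ^ 2 * ‖ψ (i, 2)‖ ^ 2
      + ‖ψ (i, 1)‖ ^ 2 * ‖ψ (i, 2)‖ ^ 2) / t)) / 3
      ≤ ‖(1 / (Real.sqrt 3 : ℂ)) * (ψ (i, 0) + ψ (i, 1) + ψ (i, 2))‖ ^ 2 := by
    intro i
    rw [norm_uniform_color_sq]
    have h := norm_add_add_sq_ge (ψ (i, 0)) (ψ (i, 1)) (ψ (i, 2))
    have h01 := amgm ‖ψ (i, 0)‖ ‖ψ (i, 1)‖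
    have h02 := amgm ‖ψ (i, 0)‖ ‖ψ (i, 2)‖
    have h12 := amgm ‖ψ (i, 1)‖ ‖ψ (i, 2)‖
    rw [add_div, add_div]
    linarith
  refine le_trans ?_ (Finset.sum_le_sum fun i _ => hpt i)
  have hψ' : ∑ i, (‖ψ (i, 0)‖ ^ 2 + ‖ψ (i, 1)‖ ^ 2 + ‖ψ (i, 2)‖ ^ 2) = 1 := by
    rw [← hψ, Fintype.sum_prod_type]
    simp only [Fin.sum_univ_three]
  rw [← Finset.sum_div, Finset.sum_sub_distrib, hψ', Finset.sum_add_distrib, ← Finset.sum_div,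
    Finset.sum_const, Finset.card_univ, nsmul_eq_mul]
  have : _ / t ≤ S / t := div_le_div_of_nonneg_right hS ht.le
  linarith

/-- A vector close to a multiple `w` of the uniform superposition has no small entry. -/
lemma norm_sq_ge_of_near_uniform {n : ℕ} (hn : 100 ≤ n) {x w : ℂ} (hw : 1 / 4 ≤ ‖w‖ ^ 2)
    (h : ‖x - w * (1 / (Real.sqrt n : ℂ))‖ ^ 2 ≤ 1 / (8 * (n : ℝ) ^ 6)) :
    1 / (16 * (n : ℝ)) ≤ ‖x‖ ^ 2 := by
  have hn' : (100 : ℝ) ≤ n := by exact_mod_cast hn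
  have hnorm : ‖w * (1 / (Real.sqrt n : ℂ))‖ ^ 2 = ‖w‖ ^ 2 / n := by
    rw [norm_mul, mul_pow, norm_div, norm_one, Complex.norm_real, Real.norm_eq_abs, div_pow,
      sq_abs, Real.sq_sqrt (by positivity)]
    ring
  have hpar : ‖w * (1 / (Real.sqrt n : ℂ))‖ ^ 2
      ≤ 2 * ‖x‖ ^ 2 + 2 * ‖x - w * (1 / (Real.sqrt n : ℂ))‖ ^ 2 := by
    have htri := norm_sub_le x (x - w * (1 / (Real.sqrt n : ℂ)))
    rw [sub_sub_cancel] at htri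
    nlinarith [norm_nonneg (w * (1 / (Real.sqrt n : ℂ))),
      sq_nonneg (‖x‖ - ‖x - w * (1 / (Real.sqrt n : ℂ))‖)]
  have hlow : 1 / 4 / (n : ℝ) ≤ ‖w‖ ^ 2 / n := by gcongr
  have hsmall : 1 / (8 * (n : ℝ) ^ 6) ≤ 1 / (16 * n) := by
    apply one_div_le_one_div_of_le (by positivity)
    have : (100 : ℝ) ^ 5 ≤ (n : ℝ) ^ 5 := by gcongr
    nlinarith
  have : 1 / 4 / (n : ℝ) = 4 * (1 / (16 * n)) := by field_simp; norm_num
  linarith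

/-- If the graph is not 3-colorable, assigning to each node its heaviest colour produces a
monochromatic edge. -/
lemma exists_adj_heavy_color {V : Type*} (G : SimpleGraph V) (hG : ¬ G.Colorable 3)
    (p : V → Fin 3 → ℝ) {m : ℝ} (hp : ∀ i, 3 * m ≤ p i 0 + p i 1 + p i 2) :
    ∃ i i' j, G.Adj i i' ∧ m ≤ p i j ∧ m ≤ p i' j := by
  have hc : ∀ i, ∃ j, m ≤ p i j := by
    intro i
    by_contra! h
    linarith [hp i, h 0, h 1, h 2]
  choose c hc using hc
  by_contra! h
  refine hG ⟨SimpleGraph.Coloring.mk c ?_⟩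
  intro i i' hadj heq
  have := h i i' (c i) hadj (hc i)
  rw [heq] at this
  exact absurd (hc i') (not_le.2 this)

/-- The colour-consistency test bounds colour collisions within the first register, up to the cost
`2 * η` of replacing the second register by the first. -/
lemma sum_color_pair_le {ι : Type*} [Fintype ι] (ψ φ : ι × Fin 3 → ℂ)
    (hψ : ∑ p, ‖ψ p‖ ^ 2 = 1) {ε η : ℝ} (hη : ∀ p, |‖ψ p‖ ^ 2 - ‖φ p‖ ^ 2| ≤ η)
    (hε : (∑ i : ι, ∑ j : Fin 3, ∑ j' : Fin 3,
      if j ≠ j' then ‖ψ (i, j)‖ ^ 2 * ‖φ (i, j')‖ ^ 2 else 0) ≤ ε) :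
    2 * ∑ i, (‖ψ (i, 0)‖ ^ 2 * ‖ψ (i, 1)‖ ^ 2 + ‖ψ (i, 0)‖ ^ 2 * ‖ψ (i, 2)‖ ^ 2
      + ‖ψ (i, 1)‖ ^ 2 * ‖ψ (i, 2)‖ ^ 2) ≤ ε + 2 * η := by
  have hpt : ∀ i, 2 * (‖ψ (i, 0)‖ ^ 2 * ‖ψ (i, 1)‖ ^ 2 + ‖ψ (i, 0)‖ ^ 2 * ‖ψ (i, 2)‖ ^ 2
      + ‖ψ (i, 1)‖ ^ 2 * ‖ψ (i, 2)‖ ^ 2)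
      ≤ (∑ j : Fin 3, ∑ j' : Fin 3,
          if j ≠ j' then ‖ψ (i, j)‖ ^ 2 * ‖φ (i, j')‖ ^ 2 else 0)
        + 2 * η * ∑ j, ‖ψ (i, j)‖ ^ 2 := by
    intro i
    have key : ∀ j j', ‖ψ (i, j)‖ ^ 2 * ‖ψ (i, j')‖ ^ 2
        ≤ ‖ψ (i, j)‖ ^ 2 * ‖φ (i, j')‖ ^ 2 + ‖ψ (i, j)‖ ^ 2 * η := by
      intro j j'
      rw [← mul_add]
      gcongr
      linarith [(abs_le.1 (hη (i, j'))).2]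
    simp [Fin.sum_univ_three]
    linarith [key 0 1, key 0 2, key 1 0, key 1 2, key 2 0, key 2 1]
  rw [Finset.mul_sum]
  refine (Finset.sum_le_sum fun i _ => hpt i).trans ?_
  rw [Finset.sum_add_distrib, ← Finset.mul_sum, ← Fintype.sum_prod_type (fun p => ‖ψ p‖ ^ 2), hψ]
  linarith

/-- Lemma 8 (`soundness-thm`) of the paper: for large enough `n`, if the graph
`G` on `Fin n` is not 3-colorable, then every unentangled pair of product-state
proofs `ψ (i,j) = α i * β i j`, `φ (i,j) = α' i * β' i j` is rejected by the
verifier (who performs one of the three tests uniformly at random) with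
probability `(F₁ + F₂ + F₃)/3 ≥ 1/(24 n⁶)`, where `F₁, F₂, F₃` are the failure
probabilities of the swap test, the computational-basis consistency test, and
the Fourier-basis test, respectively. -/
theorem soundness_3col :
    ∃ N : ℕ, ∀ n : ℕ, n ≥ N →
      ∀ (G : SimpleGraph (Fin n)) [DecidableRel G.Adj], ¬ G.Colorable 3 →
      ∀ (α α' : Fin n → ℂ) (β β' : Fin n → Fin 3 → ℂ),
      (∑ i, ‖α i‖ ^ 2 = 1) → (∑ i, ‖α' i‖ ^ 2 = 1) →
      (∀ i, ∑ j, ‖β i j‖ ^ 2 = 1) → (∀ i, ∑ j, ‖β' i j‖ ^ 2 = 1) →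
      ∀ (ψ φ : Fin n × Fin 3 → ℂ),
      (∀ i j, ψ (i, j) = α i * β i j) → (∀ i j, φ (i, j) = α' i * β' i j) →
      ∀ (v v' u : Fin n → ℂ),
      (∀ j, v j = (1 / (Real.sqrt 3 : ℂ)) * (ψ (j, 0) + ψ (j, 1) + ψ (j, 2))) →
      (∀ j, v' j = (1 / (Real.sqrt 3 : ℂ)) * (φ (j, 0) + φ (j, 1) + φ (j, 2))) →
      (∀ j, u j = 1 / (Real.sqrt n : ℂ)) →
      ∀ F₁ F₂ F₃ : ℝ,
      F₁ = (1 - ‖∑ p, conj (ψ p) * φ p‖ ^ 2) / 2 →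
      F₂ = (∑ i : Fin n, ∑ j : Fin 3, ∑ j' : Fin 3,
              if j ≠ j' then ‖ψ (i, j)‖ ^ 2 * ‖φ (i, j')‖ ^ 2 else 0) +
           (∑ i : Fin n, ∑ i' : Fin n,
              if G.Adj i i' then ∑ j : Fin 3, ‖ψ (i, j)‖ ^ 2 * ‖φ (i', j)‖ ^ 2 else 0) →
      F₃ = ((∑ j, ‖v j‖ ^ 2) - ‖∑ j, conj (u j) * v j‖ ^ 2) +
           ((∑ j, ‖v' j‖ ^ 2) - ‖∑ j, conj (u j) * v' j‖ ^ 2) →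
      (F₁ + F₂ + F₃) / 3 ≥ 1 / (24 * (n : ℝ) ^ 6) := by
  refine ⟨100, ?_⟩
  intro n hn G _ hG α α' β β' hα hα' hβ hβ' ψ φ hψ hφ v v' u hv hv' hu F₁ F₂ F₃ hF₁ hF₂ hF₃
  by_contra! hlt
  have hn' : (100 : ℝ) ≤ n := by exact_mod_cast hn
  have hψ1 : ∑ p, ‖ψ p‖ ^ 2 = 1 := sum_norm_sq_product hα hβ hψ
  have hφ1 : ∑ p, ‖φ p‖ ^ 2 = 1 := sum_norm_sq_product hα' hβ' hφ
  have hu1 : ∑ i, ‖u i‖ ^ 2 = 1 := by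
    simp only [hu, norm_div, norm_one, Complex.norm_real, Real.norm_eq_abs, div_pow, sq_abs,
      Real.sq_sqrt (Nat.cast_nonneg n), Finset.sum_const, Finset.card_univ, Fintype.card_fin,
      nsmul_eq_mul]
    field_simp
  have hpyth := sum_norm_sq_sub_proj u v hu1
  have hpyth' := sum_norm_sq_sub_proj u v' hu1
  have hres := Finset.sum_nonneg fun i (_ : i ∈ Finset.univ) =>
    sq_nonneg ‖v i - (∑ j, conj (u j) * v j) * u i‖
  have hres' := Finset.sum_nonneg fun i (_ : i ∈ Finset.univ) =>
    sq_nonneg ‖v' i - (∑ j, conj (u j) * v' j) * u i‖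
  have hswap := sum_sq_norm_sub_norm_le ψ φ hψ1 hφ1
  have hswap0 := Finset.sum_nonneg fun p (_ : p ∈ Finset.univ) => sq_nonneg (‖ψ p‖ - ‖φ p‖)
  set A := ∑ i : Fin n, ∑ j : Fin 3, ∑ j' : Fin 3,
    if j ≠ j' then ‖ψ (i, j)‖ ^ 2 * ‖φ (i, j')‖ ^ 2 else 0 with hA
  set B := ∑ i : Fin n, ∑ i' : Fin n,
    if G.Adj i i' then ∑ j : Fin 3, ‖ψ (i, j)‖ ^ 2 * ‖φ (i', j)‖ ^ 2 else 0 with hB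
  have hA0 : 0 ≤ A := by rw [hA]; positivity
  have hB0 : 0 ≤ B := by rw [hB]; positivity
  have hε : 1 / (24 * (n : ℝ) ^ 6) = 1 / (8 * (n : ℝ) ^ 6) / 3 := by field_simp; norm_num
  set ε := 1 / (8 * (n : ℝ) ^ 6) with hε_def
  have hε3 : ε ≤ 1 / (n : ℝ) ^ 3 := by
    apply one_div_le_one_div_of_le (by positivity)
    have : (n : ℝ) ^ 3 ≤ (n : ℝ) ^ 6 := pow_le_pow_right₀ (by linarith) (by norm_num)
    have : 0 ≤ (n : ℝ) ^ 6 := by positivity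
    linarith
  have hclose : ∀ p, |‖ψ p‖ ^ 2 - ‖φ p‖ ^ 2| ≤ 2 * (1 / (n : ℝ) ^ 3) := by
    intro p
    refine abs_sq_sub_sq_le_of_sq_sub_le (norm_nonneg _) (norm_nonneg _)
      (norm_le_one_of_sum_sq_eq_one hψ1 p) (norm_le_one_of_sum_sq_eq_one hφ1 p) (by positivity) ?_
    have h := Finset.single_le_sum (f := fun p => (‖ψ p‖ - ‖φ p‖) ^ 2) (fun _ _ => sq_nonneg _)
      (Finset.mem_univ p)
    have : (1 / (n : ℝ) ^ 3) ^ 2 = 8 * ε := by rw [hε_def]; field_simp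
    linarith
  have hpair := sum_color_pair_le ψ φ hψ1 hclose (ε := ε) (by linarith)
  have hP := uniform_color_prob_ge ψ hψ1 (S := 5 / 2 * (1 / (n : ℝ) ^ 3)) (t := 1 / (n : ℝ) ^ 2)
    (by positivity) (by linarith)
  simp only [← hv, Fintype.card_fin] at hP
  have hloss : 3 * (n : ℝ) * (1 / (n : ℝ) ^ 2) + 5 / 2 * (1 / (n : ℝ) ^ 3) / (1 / (n : ℝ) ^ 2)
      = 11 / 2 * (1 / n) := by field_simp; norm_num
  rw [hloss] at hP
  have hinv : 1 / (n : ℝ) ≤ 1 / 100 := one_div_le_one_div_of_le (by norm_num) hn'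
  have hinv3 : 1 / (n : ℝ) ^ 3 ≤ 1 / 10000 * (1 / n) := by
    have : 1 / (n : ℝ) ^ 3 = 1 / n * (1 / n) * (1 / n) := by field_simp
    rw [this]
    have h0 : 0 ≤ 1 / (n : ℝ) := by positivity
    gcongr
    nlinarith
  have hnode : ∀ i, 3 * (1 / (48 * (n : ℝ)))
      ≤ ‖ψ (i, 0)‖ ^ 2 + ‖ψ (i, 1)‖ ^ 2 + ‖ψ (i, 2)‖ ^ 2 := by
    intro i
    have h := Finset.single_le_sum (f := fun i => ‖v i - (∑ j, conj (u j) * v j) * u i‖ ^ 2)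
      (fun _ _ => sq_nonneg _) (Finset.mem_univ i)
    have hi := norm_sq_ge_of_near_uniform hn (x := v i) (w := ∑ j, conj (u j) * v j)
      (by linarith) (by rw [← hu i]; linarith)
    have hle := norm_uniform_color_sq_le (ψ (i, 0)) (ψ (i, 1)) (ψ (i, 2))
    rw [← hv i] at hle
    have : 3 * (1 / (48 * (n : ℝ))) = 1 / (16 * n) := by field_simp; norm_num
    linarith
  obtain ⟨i, i', j, hadj, hi, hi'⟩ :=
    exists_adj_heavy_color G hG (fun i j => ‖ψ (i, j)‖ ^ 2) hnode
  have hφi : 1 / (96 * (n : ℝ)) ≤ ‖φ (i', j)‖ ^ 2 := by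
    have h := (abs_le.1 (hclose (i', j))).2
    have h48 : 1 / (48 * (n : ℝ)) = 1 / 48 * (1 / n) := by field_simp
    have h96 : 1 / (96 * (n : ℝ)) = 1 / 96 * (1 / n) := by field_simp
    have h0 : 0 ≤ 1 / (n : ℝ) := by positivity
    linarith
  have hBlow : ‖ψ (i, j)‖ ^ 2 * ‖φ (i', j)‖ ^ 2 ≤ B := by
    calc ‖ψ (i, j)‖ ^ 2 * ‖φ (i', j)‖ ^ 2
        ≤ ∑ j : Fin 3, ‖ψ (i, j)‖ ^ 2 * ‖φ (i', j)‖ ^ 2 :=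
          Finset.single_le_sum (f := fun j => ‖ψ (i, j)‖ ^ 2 * ‖φ (i', j)‖ ^ 2)
            (fun _ _ => by positivity) (Finset.mem_univ j)
      _ = if G.Adj i i' then ∑ j : Fin 3, ‖ψ (i, j)‖ ^ 2 * ‖φ (i', j)‖ ^ 2 else 0 := by
          rw [if_pos hadj]
      _ ≤ ∑ i' : Fin n, if G.Adj i i' then ∑ j : Fin 3, ‖ψ (i, j)‖ ^ 2 * ‖φ (i', j)‖ ^ 2 else 0 :=
          Finset.single_le_sum (f := fun i' =>
            if G.Adj i i' then ∑ j : Fin 3, ‖ψ (i, j)‖ ^ 2 * ‖φ (i', j)‖ ^ 2 else 0)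
            (fun _ _ => by positivity) (Finset.mem_univ i')
      _ ≤ B := Finset.single_le_sum (f := fun i => ∑ i' : Fin n,
            if G.Adj i i' then ∑ j : Fin 3, ‖ψ (i, j)‖ ^ 2 * ‖φ (i', j)‖ ^ 2 else 0)
            (fun _ _ => by positivity) (Finset.mem_univ i)
  have hprod : 1 / (48 * (n : ℝ)) * (1 / (96 * n)) ≤ ‖ψ (i, j)‖ ^ 2 * ‖φ (i', j)‖ ^ 2 :=
    mul_le_mul hi hφi (by positivity) (by positivity)
  have hgap : ε ≤ 1 / (48 * (n : ℝ)) * (1 / (96 * n)) := by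
    rw [hε_def, one_div_mul_one_div]
    apply one_div_le_one_div_of_le (by positivity)
    have h4 : (100 : ℝ) ^ 4 ≤ (n : ℝ) ^ 4 := by gcongr
    calc 48 * (n : ℝ) * (96 * n) = 4608 * (n : ℝ) ^ 2 := by ring
      _ ≤ 8 * (n : ℝ) ^ 4 * (n : ℝ) ^ 2 := by gcongr; linarith
      _ = 8 * (n : ℝ) ^ 6 := by ring
  linarith
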